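/- arXiv:1612.08686 — 2 statements merged into one kernel-verified Lean document; each statement's English description precedes it below -/
import Mathlib

section
/- Let ι be a nonempty finite index set, κ a finite index set, ū : κ → ℝ, and u : ℕ → ι → ℝ a sequence of vectors (the backward-Euler iterates). Assume: (i) ū(c) ≥ 0 for all c ∈ κ; (ii) u(0)(b) ≥ 0 for all b ∈ ι; (iii) (discrete minimum growth) for every n ∈ ℕ and every a ∈ ι such that u(n+1) has a discrete minimum at a relative to ū, one has u(n+1)(a) ≥ u(n)(a). Then u(n)(b) ≥ 0 for every n ∈ ℕ and every b ∈ ι. -/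
/-- A vector `v : ι → ℝ` has a discrete minimum at `a` relative to boundary data `uBar`. -/
def IsDiscreteMin {ι κ : Type*} (v : ι → ℝ) (uBar : κ → ℝ) (a : ι) : Prop :=
  (∀ b, v a ≤ v b) ∧ (∀ c, v a ≤ uBar c)

/-- Positivity preservation (Theorem 3.4): a fully discrete scheme whose increments are
nonnegative at discrete minima preserves positivity at all time steps. -/
theorem positivity_preservation {ι κ : Type*} [Fintype ι] [Nonempty ι] [Fintype κ]
    (uBar : κ → ℝ) (u : ℕ → ι → ℝ)
    (hBar : ∀ c, 0 ≤ uBar c)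
    (h0 : ∀ b, 0 ≤ u 0 b)
    (hLED : ∀ n : ℕ, ∀ a : ι, IsDiscreteMin (u (n + 1)) uBar a → u n a ≤ u (n + 1) a) :
    ∀ n : ℕ, ∀ b : ι, 0 ≤ u n b := by
  intro n
  induction n with
  | zero => exact h0
  | succ n ih =>
    intro b
    obtain ⟨a, ha⟩ := Finite.exists_min (u (n + 1))
    by_contra! hb
    have hneg : u (n + 1) a < 0 := (ha b).trans_lt hb
    have hmin : IsDiscreteMin (u (n + 1)) uBar a :=
      ⟨ha, fun c => hneg.le.trans (hBar c)⟩
    exact hneg.not_ge ((ih a).trans (hLED n a hmin))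
end

section
/- Let ι be a nonempty finite index set, κ a finite index set, ū : κ → ℝ, and u : ℕ → ι → ℝ a sequence of vectors. Assume the discrete local-extremum-diminishing property: for every n ∈ ℕ and every a ∈ ι such that u(n+1) has a discrete maximum at a relative to ū, one has u(n+1)(a) ≤ u(n)(a). Then for every M ∈ ℝ such that u(0)(b) ≤ M for all b ∈ ι and ū(c) ≤ M for all c ∈ κ, one has u(n)(b) ≤ M for every n ∈ ℕ and every b ∈ ι. -/
/-- A vector `v : ι → ℝ` has a discrete maximum at `a` relative to boundary data `uBar`. -/
def IsDiscreteMax {ι κ : Type*} (v : ι → ℝ) (uBar : κ → ℝ) (a : ι) : Prop :=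
  (∀ b, v b ≤ v a) ∧ (∀ c, uBar c ≤ v a)

/-- Corollary 3.5: a fully discrete scheme whose increments are nonpositive at discrete
maxima produces solutions bounded above, at every time step, by the maximum of the
initial data and the boundary data. -/
theorem dmp_transient {ι κ : Type*} [Fintype ι] [Nonempty ι] [Fintype κ]
    (uBar : κ → ℝ) (u : ℕ → ι → ℝ)
    (hLED : ∀ n : ℕ, ∀ a : ι, IsDiscreteMax (u (n + 1)) uBar a → u (n + 1) a ≤ u n a) :
    ∀ M : ℝ, (∀ b, u 0 b ≤ M) → (∀ c, uBar c ≤ M) →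
      ∀ n : ℕ, ∀ b : ι, u n b ≤ M := by
  intro M h0 hM n
  induction n with
  | zero => exact h0
  | succ n ih =>
    obtain ⟨a, ha⟩ := Finite.exists_max (u (n + 1))
    by_contra! h
    obtain ⟨b, hb⟩ := h
    have hMa : M < u (n + 1) a := hb.trans_le (ha b)
    exact hMa.not_ge ((hLED n a ⟨ha, fun c => (hM c).trans hMa.le⟩).trans (ih a))
end
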